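/- (Pointwise bound in the proof of Proposition 4.3) Let σ_f, σ_l > 0 and let k be the Gaussian kernel on ℝⁿ. Given points x̂₁, …, x̂_N ∈ ℝⁿ and x̂₊₁, …, x̂₊_N ∈ ℝⁿ, λ > 0, let K, K³, W, β, C be as in the context. Then for all x, c ∈ ℝⁿ, √((β(x) − β(c))ᵀ K³ (β(x) − β(c))) ≤ C · √(k(x, x) + k(c, c) − 2 k(x, c)). -/

import Mathlib

open Matrix
open scoped BigOperators

/-- The Gaussian kernel on `ℝⁿ` with parameters `σf, σl`. -/
noncomputable def gaussianKernel (σf σl : ℝ) {n : ℕ}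
    (x y : EuclideanSpace ℝ (Fin n)) : ℝ :=
  σf ^ 2 * Real.exp (-‖x - y‖ ^ 2 / (2 * σl ^ 2))

/-- The entrywise exponential of a real positive semidefinite matrix is positive semidefinite. -/
theorem Matrix.PosSemidef.map_exp {ι : Type*} [Finite ι] {A : Matrix ι ι ℝ}
    (hA : A.PosSemidef) : (A.map Real.exp).PosSemidef := by
  have := Fintype.ofFinite ι
  have hpow (m : ℕ) : (A.map (· ^ m)).PosSemidef := by
    induction m with
    | zero =>
      convert posSemidef_vecMulVec_self_star (1 : ι → ℝ) using 1
      ext i j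
      simp [vecMulVec_apply]
    | succ m ih =>
      have hsucc : A.map (· ^ (m + 1)) = A.map (· ^ m) ⊙ A := by
        ext i j
        simp [pow_succ]
      exact hsucc ▸ ih.hadamard hA
  have hsum (m : ℕ) :
      (∑ r ∈ Finset.range m, ((r.factorial : ℝ)⁻¹ • A.map (· ^ r))).PosSemidef :=
    posSemidef_sum _ fun r _ => (hpow r).smul (by positivity)
  have hlim : Filter.Tendsto
      (fun m => ∑ r ∈ Finset.range m, ((r.factorial : ℝ)⁻¹ • A.map (· ^ r)))
      Filter.atTop (nhds (A.map Real.exp)) := by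
    refine tendsto_pi_nhds.2 fun i => tendsto_pi_nhds.2 fun j => ?_
    have h := (NormedSpace.expSeries_div_hasSum_exp (A i j)).tendsto_sum_nat
    rw [← Real.exp_eq_exp_ℝ] at h
    simpa [Matrix.sum_apply, div_eq_inv_mul] using h
  refine .of_dotProduct_mulVec_nonneg ?_ fun x => ?_
  · ext i j
    simpa using hA.isHermitian.apply i j
  · have hcont : Continuous fun M : Matrix ι ι ℝ => star x ⬝ᵥ (M *ᵥ x) := by fun_prop
    exact ge_of_tendsto' ((hcont.tendsto _).comp hlim) fun m =>
      (hsum m).dotProduct_mulVec_nonneg x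

theorem gaussianKernel_comm (σf σl : ℝ) {n : ℕ} (x y : EuclideanSpace ℝ (Fin n)) :
    gaussianKernel σf σl x y = gaussianKernel σf σl y x := by
  simp only [gaussianKernel, norm_sub_rev]

/-- Gram matrices of the Gaussian kernel are positive semidefinite. -/
theorem posSemidef_gaussianKernel (σf σl : ℝ) {n : ℕ} {ι : Type*} [Finite ι]
    (p : ι → EuclideanSpace ℝ (Fin n)) :
    (Matrix.of fun i j => gaussianKernel σf σl (p i) (p j)).PosSemidef := by
  have hexp : (((σl ^ 2)⁻¹ • gram ℝ p).map Real.exp).PosSemidef :=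
    ((posSemidef_gram ℝ p).smul (by positivity)).map_exp
  let d : ι → ℝ := fun i => σf * Real.exp (-‖p i‖ ^ 2 / (2 * σl ^ 2))
  have hfactor : (Matrix.of fun i j => gaussianKernel σf σl (p i) (p j)) =
      vecMulVec d (star d) ⊙ ((σl ^ 2)⁻¹ • gram ℝ p).map Real.exp := by
    ext i j
    have hsplit : -‖p i - p j‖ ^ 2 / (2 * σl ^ 2) = -‖p i‖ ^ 2 / (2 * σl ^ 2)
        + -‖p j‖ ^ 2 / (2 * σl ^ 2) + (σl ^ 2)⁻¹ * inner ℝ (p i) (p j) := by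
      rw [norm_sub_sq_real, div_eq_mul_inv, div_eq_mul_inv, div_eq_mul_inv, mul_inv]
      ring
    simp only [of_apply, gaussianKernel, hsplit, Real.exp_add, hadamard_apply, vecMulVec_apply,
      map_apply, Matrix.smul_apply, gram_apply, smul_eq_mul, star_trivial, d]
    ring
  exact hfactor ▸ (posSemidef_vecMulVec_self_star d).hadamard hexp

/-- A real positive semidefinite matrix is the Gram matrix of the rows of some matrix. -/
theorem Matrix.PosSemidef.exists_eq_mul_transpose {ι : Type*} [Finite ι] {A : Matrix ι ι ℝ}
    (hA : A.PosSemidef) : ∃ (m : ℕ) (B : Matrix ι (Fin m) ℝ), A = B * Bᵀ := by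
  obtain ⟨m, v, rfl⟩ := posSemidef_iff_eq_sum_vecMulVec.mp hA
  refine ⟨m, (Matrix.of v)ᵀ, ?_⟩
  ext i j
  simp [Matrix.sum_apply, vecMulVec_apply, mul_apply]

theorem Matrix.sum_sum_mul_eq_trace {m n : Type*} [Fintype m] [Fintype n]
    (A B : Matrix m n ℝ) : ∑ i, ∑ j, A i j * B i j = (A * Bᵀ).trace := by
  simp [trace, mul_apply]

/-- The Euclidean norm of `M *ᵥ f` is bounded by the Frobenius norm of `M` times that of `f`. -/
theorem Matrix.mulVec_dotProduct_self_le {m n : Type*} [Fintype m] [Fintype n]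
    (M : Matrix m n ℝ) (f : n → ℝ) :
    (M *ᵥ f) ⬝ᵥ (M *ᵥ f) ≤ (M * Mᵀ).trace * (f ⬝ᵥ f) := by
  rw [← sum_sum_mul_eq_trace, Finset.sum_mul, dotProduct]
  refine Finset.sum_le_sum fun i _ => ?_
  simpa [mulVec, dotProduct, sq] using Finset.sum_mul_sq_le_sq_mul_sq Finset.univ (M i) f

theorem Matrix.mulVec_dotProduct_gram_mulVec_le {ι m n : Type*} [Fintype ι] [Fintype m]
    [Fintype n] (W : Matrix ι ι ℝ) (Φ : Matrix ι m ℝ) (Ψ : Matrix ι n ℝ) (f : m → ℝ) :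
    (W *ᵥ (Φ *ᵥ f)) ⬝ᵥ ((Ψ * Ψᵀ) *ᵥ (W *ᵥ (Φ *ᵥ f))) ≤
      (∑ i, ∑ j, (W * (Φ * Φᵀ) * Wᵀ) i j * (Ψ * Ψᵀ) i j) * (f ⬝ᵥ f) := by
  convert mulVec_dotProduct_self_le (Ψᵀ * W * Φ) f using 1
  · rw [← mulVec_mulVec, ← mulVec_mulVec, ← mulVec_mulVec, dotProduct_mulVec, ← mulVec_transpose]
  · rw [sum_sum_mul_eq_trace]
    congr 1
    simp only [transpose_mul, transpose_transpose]
    rw [← Matrix.mul_assoc, trace_mul_comm]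
    simp only [Matrix.mul_assoc]

theorem cme_pointwise_rkhs_bound {n N : ℕ} (σf σl : ℝ)
    (hσf : 0 < σf) (hσl : 0 < σl)
    (k : EuclideanSpace ℝ (Fin n) → EuclideanSpace ℝ (Fin n) → ℝ)
    (hk : k = gaussianKernel σf σl)
    (xh xp : Fin N → EuclideanSpace ℝ (Fin n))
    (lam : ℝ) (hlam : 0 < lam)
    (K : Matrix (Fin N) (Fin N) ℝ) (hKdef : ∀ i j, K i j = k (xh i) (xh j))
    (K3 : Matrix (Fin N) (Fin N) ℝ) (hK3def : ∀ i j, K3 i j = k (xp i) (xp j))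
    (W : Matrix (Fin N) (Fin N) ℝ)
    (hW : W = (K + ((N : ℝ) * lam) • (1 : Matrix (Fin N) (Fin N) ℝ))⁻¹)
    (β : EuclideanSpace ℝ (Fin n) → (Fin N → ℝ))
    (hβ : ∀ x, β x = W *ᵥ (fun i => k x (xh i)))
    (C : ℝ) (hC : C = Real.sqrt (∑ i, ∑ j, (W * K * Wᵀ) i j * K3 i j)) :
    ∀ x c : EuclideanSpace ℝ (Fin n),
      Real.sqrt ((β x - β c) ⬝ᵥ (K3 *ᵥ (β x - β c))) ≤
        C * Real.sqrt (k x x + k c c - 2 * k x c) := by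
  intro x c
  subst hk
  have hK3 : K3.PosSemidef := by
    convert posSemidef_gaussianKernel σf σl xp using 1
    ext i j
    exact hK3def i j
  obtain ⟨s, Ψ, rfl⟩ := hK3.exists_eq_mul_transpose
  let p : Fin N ⊕ Bool → EuclideanSpace ℝ (Fin n) := Sum.elim xh (fun b => cond b x c)
  obtain ⟨r, B, hB⟩ := (posSemidef_gaussianKernel σf σl p).exists_eq_mul_transpose
  have hker (a b) : gaussianKernel σf σl (p a) (p b) = B a ⬝ᵥ B b := congr_fun₂ hB a b
  let Φ : Matrix (Fin N) (Fin r) ℝ := B.submatrix Sum.inl id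
  let f : Fin r → ℝ := B (.inr true) - B (.inr false)
  have hKΦ : K = Φ * Φᵀ := by
    ext i j
    exact (hKdef i j).trans (hker (.inl i) (.inl j))
  have hβf : β x - β c = W *ᵥ (Φ *ᵥ f) := by
    rw [hβ, hβ, ← mulVec_sub]
    congr 1
    ext i
    have hx := hker (.inl i) (.inr true)
    have hc := hker (.inl i) (.inr false)
    rw [gaussianKernel_comm] at hx hc
    exact (congr_arg₂ _ hx hc).trans (dotProduct_sub _ _ _).symm
  have hf : gaussianKernel σf σl x x + gaussianKernel σf σl c c
      - 2 * gaussianKernel σf σl x c = f ⬝ᵥ f := by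
    have hxx : gaussianKernel σf σl x x = _ := hker (.inr true) (.inr true)
    have hcc : gaussianKernel σf σl c c = _ := hker (.inr false) (.inr false)
    have hxc : gaussianKernel σf σl x c = _ := hker (.inr true) (.inr false)
    simp only [f, sub_dotProduct, dotProduct_sub, hxx, hcc, hxc,
      dotProduct_comm (B (.inr false)) (B (.inr true))]
    ring
  have hff := dotProduct_self_star_nonneg f
  rw [star_trivial] at hff
  rw [hC, hf, hβf, hKΦ, ← Real.sqrt_mul' _ hff]
  exact Real.sqrt_le_sqrt (mulVec_dotProduct_gram_mulVec_le W Φ Ψ f)
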